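/- There is a dense open subset U ⊆ ℂ × ℂ^N such that for all (γ,λ) ∈ U and every z ∈ ℂ with z ∉ (γ + ℤ + τℤ) ∪ (−γ + ℤ + τℤ), the matrix R(z,λ) is invertible. -/

import Mathlib

open scoped BigOperators
open Complex Matrix Filter Topology

noncomputable section

namespace EllipticQG

/-- Jacobi's first theta function `θ(z) = -∑_{j ∈ ℤ+1/2} e^{πij²τ + 2πij(z+1/2)}`. -/
def theta (τ z : ℂ) : ℂ :=
  -∑' j : ℤ, Complex.exp ((Real.pi : ℂ) * Complex.I * ((j : ℂ) + 1 / 2) ^ 2 * τ +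
      2 * (Real.pi : ℂ) * Complex.I * ((j : ℂ) + 1 / 2) * (z + 1 / 2))

/-- `α(z,μ) = θ(z)θ(μ+γ)/(θ(z-γ)θ(μ))`. -/
def alphaF (τ γ z μ : ℂ) : ℂ :=
  theta τ z * theta τ (μ + γ) / (theta τ (z - γ) * theta τ μ)

/-- `β(z,μ) = -θ(z+μ)θ(γ)/(θ(z-γ)θ(μ))`. -/
def betaF (τ γ z μ : ℂ) : ℂ :=
  -(theta τ (z + μ) * theta τ γ) / (theta τ (z - γ) * theta τ μ)

/-- The elliptic dynamical R-matrix of `E_{τ,γ/2}(gl_N)` on `ℂ^N ⊗ ℂ^N`.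
Entry `((i,j),(k,l))` is the coefficient of `e_i ⊗ e_j` in `R (e_k ⊗ e_l)`. -/
def Rmat (N : ℕ) (τ γ z : ℂ) (lam : Fin N → ℂ) :
    Matrix (Fin N × Fin N) (Fin N × Fin N) ℂ := fun p q =>
  if p.1 = p.2 then (if q = p then 1 else 0)
  else (if q = p then alphaF τ γ z (lam p.1 - lam p.2) else 0) +
    (if q = (p.2, p.1) then betaF τ γ z (lam p.1 - lam p.2) else 0)

/-- `λ - γ ∑_{c ∈ S} h^{(c)}` evaluated on the configuration `g` of basis indices. -/
def shiftL {n N : ℕ} (γ : ℂ) (lam : Fin N → ℂ) (S : Finset (Fin n)) (g : Fin n → Fin N) :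
    Fin N → ℂ :=
  fun i => lam i - γ * ((S.filter fun c => g c = i).card : ℂ)

/-- `R(z, λ - γ ∑_{c∈S} h^{(c)})^{(a b)}` acting on `(ℂ^N)^{⊗ n}`. -/
def Rop (N n : ℕ) (τ γ z : ℂ) (lam : Fin N → ℂ) (S : Finset (Fin n)) (a b : Fin n) :
    Matrix (Fin n → Fin N) (Fin n → Fin N) ℂ := fun f g =>
  if ∀ c, c ≠ a → c ≠ b → f c = g c then
    Rmat N τ γ z (shiftL γ lam S g) (f a, f b) (g a, g b)
  else 0

/-- The operators `W_n(z,λ)`, defined recursively:  `W_1 = 1` and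
`W_{n+1}(z,λ) = R(z_1-z_2, λ-γ∑_{j=3}^{n+1}h^{(j)})^{(12)} ⋯ R(z_1-z_{n+1},λ)^{(1 n+1)}
  (1 ⊗ W_n(z_2,…,z_{n+1}, λ-γh^{(1)}))` (tensor factors indexed `0,…,n`). -/
def Wrec (N : ℕ) (τ γ : ℂ) : (n : ℕ) → (Fin n → ℂ) → (Fin N → ℂ) →
    Matrix (Fin n → Fin N) (Fin n → Fin N) ℂ
  | 0, _, _ => 1
  | n + 1, z, lam =>
    (((List.finRange n).map fun j : Fin n =>
      Rop N (n + 1) τ γ (z 0 - z j.succ) lam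
        (Finset.univ.filter fun c : Fin (n + 1) => j.succ < c) 0 j.succ).prod) *
      Matrix.of (fun f g : Fin (n + 1) → Fin N =>
        if f 0 = g 0 then
          Wrec N τ γ n (fun j => z j.succ) (fun i => lam i - if g 0 = i then γ else 0)
            (Fin.tail f) (Fin.tail g)
        else 0)

/-- `W^S_n(λ) = W_n(z^S, λ)` with `z^S = (0, γ, 2γ, …, (n-1)γ)`. -/
def WS (N n : ℕ) (τ γ : ℂ) (lam : Fin N → ℂ) :
    Matrix (Fin n → Fin N) (Fin n → Fin N) ℂ :=
  Wrec N τ γ n (fun j => ((j : ℕ) : ℂ) * γ) lam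

/-- `z^∧ = ((n-1)γ, …, 2γ, γ, 0)`. -/
def zWedge (n : ℕ) (γ : ℂ) : Fin n → ℂ := fun j => ((n - 1 - (j : ℕ) : ℕ) : ℂ) * γ

/-- `W^∧_n(λ) = lim_{z → z^∧} ∏_{j=1}^{n-1} (z_j - z_{j+1} - γ) · ρ W_n(z,λ) ρ`,
where `ρ` reverses the order of the tensor factors. -/
def Wwedge (N n : ℕ) (τ γ : ℂ) (lam : Fin N → ℂ) :
    Matrix (Fin n → Fin N) (Fin n → Fin N) ℂ :=
  limUnder (𝓝[≠] zWedge n γ) fun z : Fin n → ℂ =>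
    (∏ j : Fin n, if h : (j : ℕ) + 1 < n then z j - z ⟨(j : ℕ) + 1, h⟩ - γ else 1) •
      Matrix.of fun f g : Fin n → Fin N => Wrec N τ γ n z lam (f ∘ Fin.rev) (g ∘ Fin.rev)

/-- The space `S²(ℂ^N)` of symmetric tensors in `ℂ^N ⊗ ℂ^N`. -/
def symPair (N : ℕ) : Submodule ℂ ((Fin N × Fin N) → ℂ) where
  carrier := {v | ∀ p : Fin N × Fin N, v p = v (p.2, p.1)}
  add_mem' := by intro a b ha hb p; simp only [Pi.add_apply, ha p, hb p]
  zero_mem' := by intro p; rfl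
  smul_mem' := by intro c v hv p; simp only [Pi.smul_apply, hv p]

/-- `R^{reg}(γ,λ) = lim_{z→γ} (z-γ) R(z,λ)`. -/
def Rreg (N : ℕ) (τ γ : ℂ) (lam : Fin N → ℂ) : Matrix (Fin N × Fin N) (Fin N × Fin N) ℂ :=
  limUnder (𝓝[≠] γ) fun z : ℂ => (z - γ) • Rmat N τ γ z lam

/-- The flip `P : u ⊗ v ↦ v ⊗ u` on `ℂ^N ⊗ ℂ^N`. -/
def Pmat (N : ℕ) : Matrix (Fin N × Fin N) (Fin N × Fin N) ℂ := fun p q =>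
  if q = (p.2, p.1) then 1 else 0

/-- The space `S^n(ℂ^N)` of symmetric tensors in `(ℂ^N)^{⊗n}`. -/
def symTensors (N n : ℕ) : Submodule ℂ ((Fin n → Fin N) → ℂ) where
  carrier := {v | ∀ (σ : Equiv.Perm (Fin n)) (f : Fin n → Fin N), v (f ∘ σ) = v f}
  add_mem' := by intro a b ha hb σ f; simp only [Pi.add_apply, ha σ f, hb σ f]
  zero_mem' := by intro σ f; rfl
  smul_mem' := by intro c v hv σ f; simp only [Pi.smul_apply, hv σ f]

/-- `J_n(ℂ^N)`: the span of tensors `σ v - sign(σ) v`. -/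
def Jspan (N n : ℕ) : Submodule ℂ ((Fin n → Fin N) → ℂ) :=
  Submodule.span ℂ {w | ∃ (σ : Equiv.Perm (Fin n)) (v : (Fin n → Fin N) → ℂ),
    w = (fun f => v (f ∘ σ)) - ((Equiv.Perm.sign σ : ℤ) : ℂ) • v}

/-- `ℂ^N ⊗ W ⊆ ℂ^N ⊗ (ℂ^N)^{⊗ n}` for a subspace `W ⊆ (ℂ^N)^{⊗ n}`. -/
def consSlice (N n : ℕ) (W : Submodule ℂ ((Fin n → Fin N) → ℂ)) :
    Submodule ℂ ((Fin (n + 1) → Fin N) → ℂ) where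
  carrier := {v | ∀ i : Fin N, (fun g : Fin n → Fin N => v (Fin.cons i g)) ∈ W}
  add_mem' := by intro a b ha hb i; exact W.add_mem (ha i) (hb i)
  zero_mem' := by intro i; exact W.zero_mem
  smul_mem' := by intro c v hv i; exact W.smul_mem c (hv i)

/-- The `L`-operator of `V^{⊗n}(w)`:
`L(z,λ) = R(z-w, λ-γ∑_{j=2}^n h^{(j)})^{(01)} ⋯ R(z-w-γ(n-1), λ)^{(0n)}`,
acting on `ℂ^N ⊗ (ℂ^N)^{⊗n}` with factors numbered `0,…,n`. -/
def Lop (N n : ℕ) (τ γ z w : ℂ) (lam : Fin N → ℂ) :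
    Matrix (Fin (n + 1) → Fin N) (Fin (n + 1) → Fin N) ℂ :=
  ((List.finRange n).map fun j : Fin n =>
    Rop N (n + 1) τ γ (z - w - (j : ℕ) * γ) lam
      (Finset.univ.filter fun c : Fin (n + 1) => j.succ < c) 0 j.succ).prod

/-- The `L`-operator for the opposite coproduct:
`L'(z,λ) = R(z-w-γ(n-1), λ-γ∑_{j=1}^{n-1} h^{(j)})^{(0n)} ⋯ R(z-w, λ)^{(01)}`. -/
def Lop' (N n : ℕ) (τ γ z w : ℂ) (lam : Fin N → ℂ) :
    Matrix (Fin (n + 1) → Fin N) (Fin (n + 1) → Fin N) ℂ :=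
  (((List.finRange n).reverse).map fun j : Fin n =>
    Rop N (n + 1) τ γ (z - w - (j : ℕ) * γ) lam
      (Finset.univ.filter fun c : Fin (n + 1) => 0 < c ∧ c < j.succ) 0 j.succ).prod

/-- `Id ⊗ M` on `ℂ^N ⊗ (ℂ^N)^{⊗n}`. -/
def idTensor (N n : ℕ) (M : Matrix (Fin n → Fin N) (Fin n → Fin N) ℂ) :
    Matrix (Fin (n + 1) → Fin N) (Fin (n + 1) → Fin N) ℂ :=
  Matrix.of fun f g => if f 0 = g 0 then M (Fin.tail f) (Fin.tail g) else 0

/-- `Id ⊗ M(λ - γ h^{(0)})` on `ℂ^N ⊗ (ℂ^N)^{⊗n}`. -/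
def idTensorShift (N n : ℕ) (γ : ℂ)
    (M : (Fin N → ℂ) → Matrix (Fin n → Fin N) (Fin n → Fin N) ℂ) (lam : Fin N → ℂ) :
    Matrix (Fin (n + 1) → Fin N) (Fin (n + 1) → Fin N) ℂ :=
  Matrix.of fun f g =>
    if f 0 = g 0 then M (fun i => lam i - if g 0 = i then γ else 0) (Fin.tail f) (Fin.tail g)
    else 0

/-- The zero-weight symmetric tensor `e`: the sum of all `e_{i_1} ⊗ ⋯ ⊗ e_{i_n}` over
sequences in which each index occurs exactly `ℓ` times. -/
def evec (N n ℓ : ℕ) : (Fin n → Fin N) → ℂ := fun f =>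
  if ∀ i : Fin N, (Finset.univ.filter fun j => f j = i).card = ℓ then 1 else 0

/-- The multi-index of `ē = e_1^{⊗ℓ} ⊗ ⋯ ⊗ e_N^{⊗ℓ}`. -/
def barIdx (N ℓ : ℕ) : Fin (N * ℓ) → Fin N := fun j =>
  ⟨j.val / ℓ, by
    have h : (j : ℕ) < ℓ * N := by rw [Nat.mul_comm ℓ N]; exact j.isLt
    exact Nat.div_lt_of_lt_mul h⟩

/-- `g_{N,ℓ}(λ) = ∏_{1≤j<k≤N} ∏_{s=1}^ℓ θ(λ_j-λ_k+γs)/θ(λ_j-λ_k-γ(s-1))`. -/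
def gfun (N ℓ : ℕ) (τ γ : ℂ) (lam : Fin N → ℂ) : ℂ :=
  ∏ j : Fin N, ∏ k : Fin N,
    if j < k then
      ∏ s ∈ Finset.Icc 1 ℓ,
        theta τ (lam j - lam k + γ * (s : ℂ)) / theta τ (lam j - lam k - γ * ((s : ℂ) - 1))
    else 1

/-- The permutation induced by a word in the generators `s_1, …, s_n` of `S_{n+1}`:
`π_k = s_{a_1} ∘ ⋯ ∘ s_{a_k}` (letters `a` act as the transposition of `a` and `a+1`). -/
def permOfWord {n : ℕ} : List (Fin n) → Equiv.Perm (Fin (n + 1))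
  | [] => 1
  | a :: rest => Equiv.swap a.castSucc a.succ * permOfWord rest

/-- The product of R-matrices attached to a word (with accumulated permutation `π`):
`W_w(z,λ) = F_k ⋯ F_1` where for the `t`-th letter `a`
`F_t = R(z_{π(a)} - z_{π(a+1)}, λ - γ ∑_{b<a} h^{(π(b))})^{(π(a), π(a+1))}`,
`π = π_{t-1}` the permutation induced by the earlier letters. -/
def Wword (N : ℕ) {n : ℕ} (τ γ : ℂ) (z : Fin (n + 1) → ℂ) (lam : Fin N → ℂ) :
    List (Fin n) → Equiv.Perm (Fin (n + 1)) →
      Matrix (Fin (n + 1) → Fin N) (Fin (n + 1) → Fin N) ℂ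
  | [], _ => 1
  | a :: rest, π =>
      Wword N τ γ z lam rest (π * Equiv.swap a.castSucc a.succ) *
        Rop N (n + 1) τ γ (z (π a.castSucc) - z (π a.succ)) lam
          ((Finset.univ.filter fun c : Fin (n + 1) => (c : ℕ) < (a : ℕ)).image π)
          (π a.castSucc) (π a.succ)

/-- The fused R-matrix `𝓡_{V^{⊗m}(z), V^{⊗n}(w)}(λ)` on `(ℂ^N)^{⊗(m+n)}`
(first block: factors `0,…,m-1`; second block: factors `m,…,m+n-1`). -/
def Rmn (N m n : ℕ) (τ γ z w : ℂ) (lam : Fin N → ℂ) :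
    Matrix (Fin (m + n) → Fin N) (Fin (m + n) → Fin N) ℂ :=
  ((List.finRange m).map fun a : Fin m =>
    ((List.finRange n).map fun j : Fin n =>
      Rop N (m + n) τ γ (z + (a : ℕ) * γ - w - (j : ℕ) * γ) lam
        (Finset.univ.filter fun c : Fin (m + n) =>
          (c : ℕ) < (a : ℕ) ∨ m + (j : ℕ) < (c : ℕ))
        (Fin.castAdd n a) (Fin.natAdd m j)).prod).prod

/-- `A ⊗ B ⊆ (ℂ^N)^{⊗m} ⊗ (ℂ^N)^{⊗n}`, realised as `(A ⊗ V₂) ∩ (V₁ ⊗ B)`. -/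
def blockSub (N m n : ℕ) (A : Submodule ℂ ((Fin m → Fin N) → ℂ))
    (B : Submodule ℂ ((Fin n → Fin N) → ℂ)) :
    Submodule ℂ ((Fin (m + n) → Fin N) → ℂ) where
  carrier := {v |
    (∀ g : Fin n → Fin N, (fun f : Fin m → Fin N => v (Fin.append f g)) ∈ A) ∧
    ∀ f : Fin m → Fin N, (fun g : Fin n → Fin N => v (Fin.append f g)) ∈ B}
  add_mem' := by
    intro x y hx hy
    exact ⟨fun g => A.add_mem (hx.1 g) (hy.1 g), fun f => B.add_mem (hx.2 f) (hy.2 f)⟩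
  zero_mem' := ⟨fun _ => A.zero_mem, fun _ => B.zero_mem⟩
  smul_mem' := by
    intro c x hx
    exact ⟨fun g => A.smul_mem c (hx.1 g), fun f => B.smul_mem c (hx.2 f)⟩

/-- Matrix element `L_{jk}(z,λ)` of the `L`-operator (evaluation point `w = 0`),
as an operator on `(ℂ^N)^{⊗n}`: `L(z,λ)(e_k ⊗ v) = ∑_j e_j ⊗ L_{jk}(z,λ) v`. -/
def LmatEl (N n : ℕ) (τ γ z : ℂ) (lam : Fin N → ℂ) (j k : Fin N)
    (v : (Fin n → Fin N) → ℂ) : (Fin n → Fin N) → ℂ := fun g =>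
  (Lop N n τ γ z 0 lam).mulVec
    (fun f => (if f 0 = k then (1 : ℂ) else 0) * v (Fin.tail f)) (Fin.cons j g)

/-- `L_{j_{σ(1)} j_1}(z, λ-γ(ω_{j_2}+⋯+ω_{j_m})) ∘ ⋯ ∘ L_{j_{σ(m)} j_m}(z-(m-1)γ, λ)`. -/
def chainT (N n m : ℕ) (τ γ z : ℂ) (lam : Fin N → ℂ) (jt : Fin m → Fin N)
    (σ : Equiv.Perm (Fin m)) (v : (Fin n → Fin N) → ℂ) : (Fin n → Fin N) → ℂ :=
  (List.finRange m).foldr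
    (fun (t : Fin m) acc =>
      LmatEl N n τ γ (z - (t.val : ℂ) * γ)
        (fun i => lam i -
          γ * ((Finset.univ.filter fun s : Fin m => t < s ∧ jt s = i).card : ℂ))
        (jt (σ t)) (jt t) acc)
    v

/-- The transfer matrix `T_m(z)`, acting on scalar functions of `λ` via the identification
of the zero weight space of `S^{Nℓ}(ℂ^N)` with `ℂ` by the basis vector `e`:
`T_m(z) f(λ) = ∑_{j_1<⋯<j_m} ∑_{σ} (-1)^σ [L_{j_{σ(1)} j_1}(z,λ-γ(ω_{j_2}+⋯+ω_{j_m})) ⋯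
L_{j_{σ(m)} j_m}(z-(m-1)γ, λ)] e · f(λ-γ(ω_{j_1}+⋯+ω_{j_m}))`. -/
def Tm (N ℓ m : ℕ) (τ γ z : ℂ) (lam : Fin N → ℂ) (f : (Fin N → ℂ) → ℂ) : ℂ :=
  ∑ jt ∈ Finset.univ.filter fun jt : Fin m → Fin N => ∀ s t : Fin m, s < t → jt s < jt t,
    ∑ σ : Equiv.Perm (Fin m),
      ((Equiv.Perm.sign σ : ℤ) : ℂ) *
        chainT N (N * ℓ) m τ γ z lam jt σ (evec N (N * ℓ) ℓ) (barIdx N ℓ) *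
        f fun i => lam i - if ∃ t, jt t = i then γ else 0

/-- The `m`-th Ruijsenaars operator with coupling constant `ℓ`:
`M_m f(λ) = ∑_{|J|=m} ∏_{j∈J,k∉J} θ(λ_j-λ_k+ℓγ)/θ(λ_j-λ_k) · f(λ-γ∑_{j∈J}ω_j)`. -/
def Mm (N ℓ m : ℕ) (τ γ : ℂ) (f : (Fin N → ℂ) → ℂ) (lam : Fin N → ℂ) : ℂ :=
  ∑ J ∈ Finset.powersetCard m (Finset.univ : Finset (Fin N)),
    (∏ j ∈ J, ∏ k ∈ Jᶜ, theta τ (lam j - lam k + (ℓ : ℂ) * γ) / theta τ (lam j - lam k)) *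
      f fun i => lam i - if i ∈ J then γ else 0

/-- The transfer matrix with auxiliary space indexed by `ι` (weights `wt`) and quantum
space indexed by `ι₃`: `T f(λ) = ∑_μ tr_{W[μ]}(𝓡(λ)) f(λ-γμ)`. -/
def transferOp {N : ℕ} {ι ι₃ : Type} [Fintype ι] [Fintype ι₃] (γ : ℂ)
    (wt : ι → Fin N → ℂ) (R : (Fin N → ℂ) → Matrix (ι × ι₃) (ι × ι₃) ℂ)
    (f : (Fin N → ℂ) → ι₃ → ℂ) : (Fin N → ℂ) → ι₃ → ℂ := fun lam b =>
  ∑ a : ι, ∑ b' : ι₃, R lam (a, b) (a, b') * f (fun r => lam r - γ * wt a r) b'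


/-- An entire function that does not vanish identically has finite order at every point. -/
lemma analyticOrderAt_ne_top_of_entire {f : ℂ → ℂ} (hf : Differentiable ℂ f) {x : ℂ}
    (hx : f x ≠ 0) (z : ℂ) : analyticOrderAt f z ≠ ⊤ := by
  rw [Ne, AnalyticOnNhd.analyticOrderAt_eq_top_iff_eq_zero z fun w => hf.analyticAt w]
  rintro rfl
  exact hx rfl

lemma eventually_ne_zero_of_entire {f : ℂ → ℂ} (hf : Differentiable ℂ f) {x : ℂ}
    (hx : f x ≠ 0) (z : ℂ) : ∀ᶠ w in 𝓝[≠] z, f w ≠ 0 :=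
  (hf.analyticAt z).eventually_eq_zero_or_eventually_ne_zero.resolve_left fun h =>
    analyticOrderAt_ne_top_of_entire hf hx z (analyticOrderAt_eq_top.2 h)

/-- Two continuous functions agreeing wherever a nonzero entire function is nonzero are equal. -/
lemma eq_of_mul_entire_eq {f u v : ℂ → ℂ} (hf : Differentiable ℂ f) {x : ℂ} (hx : f x ≠ 0)
    (hu : Continuous u) (hv : Continuous v) (h : ∀ z, u z * f z = v z * f z) (z : ℂ) :
    u z = v z := by
  refine tendsto_nhds_unique_of_eventuallyEq (l := 𝓝[≠] z)
    (hu.continuousAt.mono_left nhdsWithin_le_nhds)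
    (hv.continuousAt.mono_left nhdsWithin_le_nhds) ?_
  filter_upwards [eventually_ne_zero_of_entire hf hx z] with w hw
  exact mul_right_cancel₀ hw (h w)

/-- An `ℕ`-valued function which is affine along translations by `a` is `a`-periodic. -/
lemma apply_add_eq_of_affine {o : ℂ → ℕ} {a : ℂ}
    (h : ∀ w, o (w + a) + o (w - a) = 2 * o w) (w : ℂ) : o (w + a) = o w := by
  have fwd : ∀ k : ℕ, (o (w + k * a) : ℤ) = o w + k * ((o (w + a) : ℤ) - o w) ∧
      (o (w + (k + 1 : ℕ) * a) : ℤ) = o w + (k + 1 : ℕ) * ((o (w + a) : ℤ) - o w) := by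
    intro k
    induction k with
    | zero => simp
    | succ k ih =>
      refine ⟨ih.2, ?_⟩
      have := h (w + (k + 1 : ℕ) * a)
      rw [show w + (k + 1 : ℕ) * a + a = w + (k + 1 + 1 : ℕ) * a by push_cast; ring,
        show w + (k + 1 : ℕ) * a - a = w + k * a by push_cast; ring] at this
      have h2 : (o (w + (k + 1 + 1 : ℕ) * a) : ℤ) + o (w + k * a) = 2 * o (w + (k + 1 : ℕ) * a) := by
        exact_mod_cast this
      rw [ih.1, ih.2] at h2
      push_cast at h2 ⊢
      linarith
  have bwd : ∀ k : ℕ, (o (w - k * a) : ℤ) = o w - k * ((o (w + a) : ℤ) - o w) ∧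
      (o (w - (k + 1 : ℕ) * a) : ℤ) = o w - (k + 1 : ℕ) * ((o (w + a) : ℤ) - o w) := by
    intro k
    induction k with
    | zero =>
      have := h w
      refine ⟨by simp, ?_⟩
      simp only [zero_add, Nat.cast_one, one_mul]
      omega
    | succ k ih =>
      refine ⟨ih.2, ?_⟩
      have := h (w - (k + 1 : ℕ) * a)
      rw [show w - (k + 1 : ℕ) * a - a = w - (k + 1 + 1 : ℕ) * a by push_cast; ring,
        show w - (k + 1 : ℕ) * a + a = w - k * a by push_cast; ring] at this
      have h2 : (o (w - k * a) : ℤ) + o (w - (k + 1 + 1 : ℕ) * a) = 2 * o (w - (k + 1 : ℕ) * a) := by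
        exact_mod_cast this
      rw [ih.1, ih.2] at h2
      push_cast at h2 ⊢
      linarith
  have h1 := (fwd (o w)).2
  have h2 := (bwd (o w)).2
  push_cast at h1 h2
  rcases lt_trichotomy (o (w + a)) (o w) with hlt | heq | hgt
  · have : (o (w + a) : ℤ) - o w ≤ -1 := by omega
    have : (0 : ℤ) ≤ o (w + ((o w : ℂ) + 1) * a) := by positivity
    nlinarith
  · exact heq
  · have : 1 ≤ (o (w + a) : ℤ) - o w := by omega
    have : (0 : ℤ) ≤ o (w - ((o w : ℂ) + 1) * a) := by positivity
    nlinarith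

/-- If the order of an entire function is `a`-periodic, then `f (z + a) / f z` is entire. -/
lemma exists_entire_quotient {f : ℂ → ℂ} (hf : Differentiable ℂ f) {x : ℂ} (hx : f x ≠ 0) {a : ℂ}
    (h : ∀ w, analyticOrderAt f (w + a) = analyticOrderAt f w) :
    ∃ g : ℂ → ℂ, Differentiable ℂ g ∧ ∀ z, g z * f z = f (z + a) := by
  have hfa : Differentiable ℂ fun z => f (z + a) := hf.comp (differentiable_id.add_const a)
  set q : ℂ → ℂ := fun z => f (z + a) / f z with hq
  have hmer : MeromorphicOn q Set.univ := fun z _ =>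
    (hfa.analyticAt z).meromorphicAt.div (hf.analyticAt z).meromorphicAt
  have hcomp (z : ℂ) : analyticOrderAt (fun w => f (w + a)) z = analyticOrderAt f (z + a) := by
    have hd : deriv (fun w : ℂ => w + a) z ≠ 0 := by simp
    exact analyticOrderAt_comp_of_deriv_ne_zero (f := f) (g := fun w : ℂ => w + a)
      (by fun_prop) hd
  have hord (z : ℂ) : meromorphicOrderAt q z = 0 := by
    rw [hq, fun_meromorphicOrderAt_div (hfa.analyticAt z).meromorphicAt
      (hf.analyticAt z).meromorphicAt, (hfa.analyticAt z).meromorphicOrderAt_eq,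
      (hf.analyticAt z).meromorphicOrderAt_eq, hcomp, h]
    obtain ⟨n, hn⟩ := ENat.ne_top_iff_exists.1 (analyticOrderAt_ne_top_of_entire hf hx z)
    rw [← hn]
    simp only [ENat.map_natCast]
    norm_cast
    simp
  have hg (z : ℂ) : AnalyticAt ℂ (toMeromorphicNFOn q Set.univ) z := by
    rw [← (meromorphicNFOn_toMeromorphicNFOn q Set.univ
      (Set.mem_univ z)).meromorphicOrderAt_nonneg_iff_analyticAt,
      meromorphicOrderAt_toMeromorphicNFOn hmer (Set.mem_univ z), hord]
  have hgd : Differentiable ℂ (toMeromorphicNFOn q Set.univ) := fun z => (hg z).differentiableAt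
  refine ⟨_, hgd, fun z => ?_⟩
  refine tendsto_nhds_unique_of_eventuallyEq (l := 𝓝[≠] z)
    (f := fun z => toMeromorphicNFOn q Set.univ z * f z) (g := fun z => f (z + a))
    ((hgd.continuous.mul hf.continuous).continuousAt.mono_left nhdsWithin_le_nhds)
    (hfa.continuous.continuousAt.mono_left nhdsWithin_le_nhds) ?_
  filter_upwards [eventually_ne_zero_of_entire hf hx z,
    hmer.toMeromorphicNFOn_eq_self_on_nhdsNE (Set.mem_univ z)] with w hw hw2
  rw [hw2, hq]
  exact div_mul_cancel₀ _ hw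

/-- An entire function with two `ℝ`-independent periods `1`, `τ` in absolute value is constant. -/
lemma apply_eq_apply_of_norm_periodic {τ : ℂ} (hτ : 0 < τ.im) {g : ℂ → ℂ}
    (hg : Differentiable ℂ g) (h1 : ∀ z, ‖g (z + 1)‖ = ‖g z‖) (h2 : ∀ z, ‖g (z + τ)‖ = ‖g z‖)
    (z w : ℂ) : g z = g w := by
  apply hg.apply_eq_apply_of_bounded
  have p1 : Function.Periodic (fun z => ‖g z‖) 1 := h1
  have p2 : Function.Periodic (fun z => ‖g z‖) τ := h2
  have hK : IsCompact ((fun p : ℝ × ℝ => (p.1 : ℂ) + p.2 * τ) '' (Set.Icc 0 1 ×ˢ Set.Icc 0 1)) :=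
    (isCompact_Icc.prod isCompact_Icc).image (by fun_prop)
  obtain ⟨C, hC⟩ := hK.exists_bound_of_continuousOn hg.continuous.continuousOn
  rw [isBounded_iff_forall_norm_le]
  refine ⟨C, ?_⟩
  rintro _ ⟨z, rfl⟩
  set y : ℝ := z.im / τ.im
  set x : ℝ := z.re - y * τ.re
  have hz : z = x + y * τ := by
    apply Complex.ext
    · simp [x]
    · simp [y, hτ.ne']
  have key : ‖g (z - ⌊y⌋ * τ - ⌊x⌋ * 1)‖ = ‖g z‖ :=
    (p1.sub_int_mul_eq ⌊x⌋).trans (p2.sub_int_mul_eq ⌊y⌋)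
  rw [← key]
  apply hC
  refine ⟨(Int.fract x, Int.fract y), ⟨⟨Int.fract_nonneg _, (Int.fract_lt_one _).le⟩,
    ⟨Int.fract_nonneg _, (Int.fract_lt_one _).le⟩⟩, ?_⟩
  simp only [Int.fract, hz]
  push_cast
  ring

/-- A nonzero entire function with `g (z + 1) = g z` and `g (z + τ) = exp (-2πi a) g z`
exists only when `a ∈ ℤ + τℤ`. -/
lemma mem_lattice_of_multiplier {τ a : ℂ} (hτ : 0 < τ.im) {g : ℂ → ℂ} (hg : Differentiable ℂ g)
    {x : ℂ} (hx : g x ≠ 0) (h1 : ∀ z, g (z + 1) = g z)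
    (h2 : ∀ z, g (z + τ) = cexp (-(2 * Real.pi * I * a)) * g z) :
    ∃ m n : ℤ, a = m + n * τ := by
  set y : ℝ := 2 * Real.pi * a.im / τ.im with hy
  have key := apply_eq_apply_of_norm_periodic hτ (g := fun z => g z * cexp (y * I * z))
    (hg.mul (by fun_prop))
    (fun z => by
      rw [h1, norm_mul, norm_mul, Complex.norm_exp, Complex.norm_exp]
      simp)
    (fun z => by
      have hre : (-(2 * Real.pi * I * a) + y * I * τ).re = 0 := by
        simp [hy]
        field_simp
        ring
      have hsplit : g (z + τ) * cexp (y * I * (z + τ)) =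
          g z * cexp (y * I * z) * cexp (-(2 * Real.pi * I * a) + y * I * τ) := by
        rw [h2, mul_add, Complex.exp_add, Complex.exp_add]
        ring
      rw [hsplit, norm_mul, Complex.norm_exp, hre, Real.exp_zero, mul_one])
  have e1 := key (x + 1) x
  have e2 := key (x + τ) x
  simp only [h1, h2, mul_add, Complex.exp_add] at e1 e2
  have ex := Complex.exp_ne_zero (y * I * x)
  have e1' : cexp (y * I * 1) = 1 := by
    have : g x * cexp (y * I * x) ≠ 0 := mul_ne_zero hx ex
    apply mul_left_cancel₀ this
    linear_combination e1
  have e2' : cexp (-(2 * Real.pi * I * a) + y * I * τ) = 1 := by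
    have : g x * cexp (y * I * x) ≠ 0 := mul_ne_zero hx ex
    apply mul_left_cancel₀ this
    rw [Complex.exp_add]
    linear_combination e2
  obtain ⟨n, hn⟩ := Complex.exp_eq_one_iff.1 e1'
  obtain ⟨k, hk⟩ := Complex.exp_eq_one_iff.1 e2'
  refine ⟨-k, n, ?_⟩
  have h0 : (2 * Real.pi * I : ℂ) ≠ 0 := Complex.two_pi_I_ne_zero
  apply mul_left_cancel₀ h0
  push_cast
  linear_combination -hk + τ * hn

lemma theta_eq_jacobiTheta₂ (τ z : ℂ) :
    theta τ z = -(cexp (Real.pi * I * τ / 4 + Real.pi * I * (z + 1 / 2)) *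
      jacobiTheta₂ (z + 1 / 2 + τ / 2) τ) := by
  rw [theta, jacobiTheta₂, ← tsum_mul_left]
  congr 1
  refine tsum_congr fun j => ?_
  rw [jacobiTheta₂_term, ← Complex.exp_add]
  congr 1
  ring

lemma differentiable_theta {τ : ℂ} (hτ : 0 < τ.im) : Differentiable ℂ (theta τ) := by
  have h : Differentiable ℂ fun z => jacobiTheta₂ (z + 1 / 2 + τ / 2) τ := fun z =>
    (differentiableAt_jacobiTheta₂_fst (z + 1 / 2 + τ / 2) hτ).comp z
      (f := fun z : ℂ => z + 1 / 2 + τ / 2) (by fun_prop)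
  rw [funext (theta_eq_jacobiTheta₂ τ)]
  exact (Differentiable.mul (by fun_prop) h).neg

lemma neg_cexp (w : ℂ) : -cexp w = cexp (w + Real.pi * I) := by
  rw [Complex.exp_add, Complex.exp_pi_mul_I, mul_neg_one]

lemma theta_neg (τ z : ℂ) : theta τ (-z) = -theta τ z := by
  rw [theta, theta, ← (Equiv.subLeft (-1 : ℤ)).tsum_eq, neg_inj, ← tsum_neg]
  refine tsum_congr fun j => ?_
  rw [neg_cexp, Complex.exp_eq_exp_iff_exists_int]
  refine ⟨-1 - j, ?_⟩
  simp only [Equiv.subLeft_apply]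
  push_cast
  ring

lemma theta_add_one (τ z : ℂ) : theta τ (z + 1) = -theta τ z := by
  rw [theta_eq_jacobiTheta₂, theta_eq_jacobiTheta₂,
    show z + 1 + 1 / 2 + τ / 2 = z + 1 / 2 + τ / 2 + 1 by ring, jacobiTheta₂_add_left,
    show Real.pi * I * τ / 4 + Real.pi * I * (z + 1 + 1 / 2) =
      Real.pi * I * τ / 4 + Real.pi * I * (z + 1 / 2) + Real.pi * I by ring,
    Complex.exp_add _ (Real.pi * I), Complex.exp_pi_mul_I]
  ring

lemma theta_add_tau (τ z : ℂ) :
    theta τ (z + τ) = cexp (-(Real.pi * I * (τ + 2 * z + 1))) * theta τ z := by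
  rw [theta_eq_jacobiTheta₂, theta_eq_jacobiTheta₂,
    show z + τ + 1 / 2 + τ / 2 = z + 1 / 2 + τ / 2 + τ by ring, jacobiTheta₂_add_left',
    mul_neg, ← mul_assoc, ← mul_assoc, ← Complex.exp_add, ← Complex.exp_add]
  congr 3
  ring

/-- The zeroth Fourier coefficient of `jacobiTheta₂` in its first variable is `1`. -/
lemma integral_jacobiTheta₂ {τ : ℂ} (hτ : 0 < τ.im) :
    ∫ x in (0 : ℝ)..1, jacobiTheta₂ x τ = 1 := by
  let f : ℤ → C(ℝ, ℂ) := fun n => ⟨fun x => jacobiTheta₂_term n x τ, by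
    unfold jacobiTheta₂_term; fun_prop⟩
  have hf (n : ℤ) : ‖(f n).restrict (⟨Set.uIcc (0 : ℝ) 1, isCompact_uIcc⟩ :
      TopologicalSpace.Compacts ℝ)‖ ≤ ‖jacobiTheta₂_term n 0 τ‖ := by
    rw [ContinuousMap.norm_le _ (norm_nonneg _)]
    intro x
    simp [f, norm_jacobiTheta₂_term]
  have hs : Summable fun n : ℤ => ‖jacobiTheta₂_term n 0 τ‖ :=
    ((summable_jacobiTheta₂_term_iff 0 τ).2 hτ).norm
  have h := intervalIntegral.hasSum_intervalIntegral_of_summable_norm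
    (Summable.of_nonneg_of_le (fun _ => norm_nonneg _) hf hs)
  refine (h.unique ?_)
  have h0 : ∫ x in (0 : ℝ)..1, f 0 x = 1 := by simp [f, jacobiTheta₂_term]
  rw [← h0]
  refine hasSum_single 0 fun n hn => ?_
  have hc : (2 * Real.pi * I * n : ℂ) ≠ 0 :=
    mul_ne_zero Complex.two_pi_I_ne_zero (by exact_mod_cast hn)
  have : ∀ x : ℝ, f n x = cexp (2 * Real.pi * I * n * x) * cexp (Real.pi * I * n ^ 2 * τ) :=
    fun x => by simp [f, jacobiTheta₂_term, Complex.exp_add]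
  simp_rw [this]
  rw [intervalIntegral.integral_mul_const, integral_exp_mul_complex hc]
  have h1 : cexp (2 * Real.pi * I * n * (1 : ℝ)) = 1 :=
    Complex.exp_eq_one_iff.2 ⟨n, by push_cast; ring⟩
  rw [h1]
  simp

lemma exists_theta_ne_zero {τ : ℂ} (hτ : 0 < τ.im) : ∃ z, theta τ z ≠ 0 := by
  by_contra! h
  have h0 (x : ℝ) : jacobiTheta₂ x τ = 0 := by
    have := h (x - 1 / 2 - τ / 2)
    rw [theta_eq_jacobiTheta₂,
      show (x - 1 / 2 - τ / 2 + 1 / 2 + τ / 2 : ℂ) = x by ring] at this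
    simpa using this
  simpa [h0] using integral_jacobiTheta₂ hτ

/-- The even part `∑_{m even} exp (πi m²τ/2 + 2πi m x)` of a theta function at `τ/2`. -/
def thetaEven (τ x : ℂ) : ℂ := ∑' s : ℤ, jacobiTheta₂_term s (2 * x) (2 * τ)

/-- The odd part `∑_{m odd} exp (πi m²τ/2 + 2πi m x)` of a theta function at `τ/2`. -/
def thetaOdd (τ x : ℂ) : ℂ :=
  ∑' s : ℤ, cexp (Real.pi * I * τ / 2 + 2 * Real.pi * I * x) *
    jacobiTheta₂_term s (2 * x + τ) (2 * τ)

/-- Pairs of integers, split according to the parity of their sum. -/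
def pairParityEquiv : (ℤ × ℤ) ⊕ (ℤ × ℤ) ≃ ℤ × ℤ :=
  Equiv.ofBijective
    (Sum.elim (fun p => (p.1 + p.2, p.1 - p.2 - 1)) fun p => (p.1 + p.2, p.1 - p.2)) <| by
  constructor
  · rintro (⟨a, b⟩ | ⟨a, b⟩) (⟨c, d⟩ | ⟨c, d⟩) h <;>
      simp only [Sum.elim_inl, Sum.elim_inr, Prod.mk.injEq, reduceCtorEq, Sum.inl.injEq,
        Sum.inr.injEq] at h ⊢ <;> omega
  · rintro ⟨a, b⟩
    rcases Int.even_or_odd' (a + b) with ⟨k, hk | hk⟩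
    · exact ⟨Sum.inr (k, a - k), by simp only [Sum.elim_inr, Prod.mk.injEq]; omega⟩
    · exact ⟨Sum.inl (k + 1, a - k - 1), by simp only [Sum.elim_inl, Prod.mk.injEq]; omega⟩

lemma pairParityEquiv_inl (p : ℤ × ℤ) :
    pairParityEquiv (Sum.inl p) = (p.1 + p.2, p.1 - p.2 - 1) := rfl

lemma pairParityEquiv_inr (p : ℤ × ℤ) :
    pairParityEquiv (Sum.inr p) = (p.1 + p.2, p.1 - p.2) := rfl

lemma theta_add_mul_theta_sub {τ : ℂ} (hτ : 0 < τ.im) (x y : ℂ) :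
    theta τ (x + y) * theta τ (x - y) =
      thetaEven τ x * thetaOdd τ y - thetaOdd τ x * thetaEven τ y := by
  let t : ℂ → ℤ → ℂ := fun z j =>
    cexp (Real.pi * I * τ / 4 + Real.pi * I * (z + 1 / 2)) *
      jacobiTheta₂_term j (z + 1 / 2 + τ / 2) τ
  have ht (z : ℂ) : Summable (t z) := ((summable_jacobiTheta₂_term_iff _ τ).2 hτ).mul_left _
  have hθ (z : ℂ) : theta τ z = -∑' j, t z j := by
    rw [theta_eq_jacobiTheta₂, jacobiTheta₂, ← tsum_mul_left]
  have hτ2 : 0 < (2 * τ).im := by simpa using hτ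
  have hE (x : ℂ) : Summable fun s : ℤ => jacobiTheta₂_term s (2 * x) (2 * τ) :=
    (summable_jacobiTheta₂_term_iff _ _).2 hτ2
  have hO (x : ℂ) : Summable fun s : ℤ => cexp (Real.pi * I * τ / 2 + 2 * Real.pi * I * x) *
      jacobiTheta₂_term s (2 * x + τ) (2 * τ) :=
    ((summable_jacobiTheta₂_term_iff _ _).2 hτ2).mul_left _
  have hprod := summable_mul_of_summable_norm (ht (x + y)).norm (ht (x - y)).norm
  rw [hθ, hθ, neg_mul_neg, tsum_mul_tsum_of_summable_norm (ht _).norm (ht _).norm,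
    ← pairParityEquiv.tsum_eq]
  have hs := (pairParityEquiv.summable_iff).2 hprod
  refine (Summable.tsum_sum (hs.comp_injective Sum.inl_injective)
    (hs.comp_injective Sum.inr_injective)).trans ?_
  rw [thetaEven, thetaOdd, thetaOdd, thetaEven,
    tsum_mul_tsum_of_summable_norm (hE _).norm (hO _).norm,
    tsum_mul_tsum_of_summable_norm (hO _).norm (hE _).norm,
    sub_eq_add_neg (∑' _, _) _, ← tsum_neg]
  congr 1
  · refine tsum_congr fun p => ?_
    simp only [t, Function.comp_apply, pairParityEquiv_inl, jacobiTheta₂_term,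
      ← Complex.exp_add]
    rw [Complex.exp_eq_exp_iff_exists_int]
    refine ⟨p.1, ?_⟩
    push_cast
    ring
  · refine tsum_congr fun p => ?_
    simp only [t, Function.comp_apply, pairParityEquiv_inr, jacobiTheta₂_term,
      ← Complex.exp_add]
    rw [neg_cexp, Complex.exp_eq_exp_iff_exists_int]
    refine ⟨p.1, ?_⟩
    push_cast
    ring

/-- Weierstrass' three-term identity, with one of the four arguments equal to `0`. -/
lemma theta_three_term {τ : ℂ} (hτ : 0 < τ.im) (z γ μ : ℂ) :
    theta τ z ^ 2 * (theta τ (γ + μ) * theta τ (γ - μ)) -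
      theta τ γ ^ 2 * (theta τ (z + μ) * theta τ (z - μ)) =
      -(theta τ μ ^ 2 * (theta τ (z + γ) * theta τ (z - γ))) := by
  have hsq (w : ℂ) : theta τ w ^ 2 =
      thetaEven τ w * thetaOdd τ 0 - thetaOdd τ w * thetaEven τ 0 := by
    rw [← theta_add_mul_theta_sub hτ, add_zero, sub_zero, sq]
  simp only [hsq, theta_add_mul_theta_sub hτ]
  ring

/-- The zeros of `theta` lie in the lattice `ℤ + τℤ`. -/
lemma mem_lattice_of_theta_eq_zero {τ a : ℂ} (hτ : 0 < τ.im) (ha : theta τ a = 0) :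
    ∃ m n : ℤ, a = m + n * τ := by
  have hd := differentiable_theta hτ
  obtain ⟨x, hx⟩ := exists_theta_ne_zero hτ
  have hfin := analyticOrderAt_ne_top_of_entire hd hx
  have hda : Differentiable ℂ fun z => theta τ (z + a) := hd.comp (differentiable_id.add_const a)
  have hda' : Differentiable ℂ fun z => theta τ (z - a) := hd.comp (differentiable_id.sub_const a)
  have hcomp (z : ℂ) :
      analyticOrderAt (fun w => theta τ (w + a)) z = analyticOrderAt (theta τ) (z + a) :=
    analyticOrderAt_comp_of_deriv_ne_zero (f := theta τ) (g := fun w : ℂ => w + a)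
      (by fun_prop) (by simp)
  have hcomp' (z : ℂ) :
      analyticOrderAt (fun w => theta τ (w - a)) z = analyticOrderAt (theta τ) (z - a) :=
    analyticOrderAt_comp_of_deriv_ne_zero (f := theta τ) (g := fun w : ℂ => w - a)
      (by fun_prop) (by simp)
  obtain ⟨c, hc⟩ : ∃ c, ∀ z, theta τ (z + a) * theta τ (z - a) = c * theta τ z ^ 2 := by
    refine ⟨-(theta τ (a + x) * theta τ (a - x)) / theta τ x ^ 2, fun z => ?_⟩
    have := theta_three_term hτ z a x
    rw [ha] at this
    field_simp
    linear_combination this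
  have hmul (z : ℂ) : analyticOrderAt (theta τ) (z + a) + analyticOrderAt (theta τ) (z - a) =
      analyticOrderAt (fun w => c * theta τ w ^ 2) z := by
    rw [← hcomp, ← hcomp', ← analyticOrderAt_mul (hda.analyticAt z) (hda'.analyticAt z)]
    exact congrArg (analyticOrderAt · z) (funext hc)
  have hc0 : c ≠ 0 := by
    rintro rfl
    have h0 : analyticOrderAt (fun w => 0 * theta τ w ^ 2) 0 = ⊤ := by
      rw [analyticOrderAt_eq_top]
      simp
    have := hmul 0
    rw [h0] at this
    exact WithTop.add_ne_top.2 ⟨hfin _, hfin _⟩ this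
  have haff (z : ℂ) : analyticOrderNatAt (theta τ) (z + a) + analyticOrderNatAt (theta τ) (z - a) =
      2 * analyticOrderNatAt (theta τ) z := by
    have hcst : analyticOrderAt (fun _ : ℂ => c) z = 0 :=
      analyticAt_const.analyticOrderAt_eq_zero.2 hc0
    have h2 : analyticOrderAt (fun w => c * theta τ w ^ 2) z =
        analyticOrderAt (theta τ) z + analyticOrderAt (theta τ) z := by
      have : (fun w => c * theta τ w ^ 2) = (fun _ : ℂ => c) * (theta τ * theta τ) := by
        ext w
        simp [sq]
      rw [this, analyticOrderAt_mul analyticAt_const ((hd.analyticAt z).mul (hd.analyticAt z)),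
        analyticOrderAt_mul (hd.analyticAt z) (hd.analyticAt z), hcst, zero_add]
    have := hmul z
    rw [h2, ← Nat.cast_analyticOrderNatAt (hfin (z + a)),
      ← Nat.cast_analyticOrderNatAt (hfin (z - a)), ← Nat.cast_analyticOrderNatAt (hfin z)] at this
    rw [two_mul]
    exact_mod_cast this
  have hper (z : ℂ) : analyticOrderAt (theta τ) (z + a) = analyticOrderAt (theta τ) z := by
    rw [← Nat.cast_analyticOrderNatAt (hfin (z + a)), ← Nat.cast_analyticOrderNatAt (hfin z),
      apply_add_eq_of_affine haff z]
  obtain ⟨g, hg, hgθ⟩ := exists_entire_quotient hd hx hper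
  have hg1 : ∀ z, g (z + 1) = g z :=
    eq_of_mul_entire_eq hd hx (hg.continuous.comp (continuous_add_const 1)) hg.continuous
      fun z => by
        have := hgθ (z + 1)
        rw [theta_add_one, add_right_comm z 1 a, theta_add_one, ← hgθ z] at this
        linear_combination -this
  have hg2 : ∀ z, g (z + τ) = cexp (-(2 * Real.pi * I * a)) * g z :=
    eq_of_mul_entire_eq hd hx (hg.continuous.comp (continuous_add_const τ))
      (hg.continuous.const_mul _) fun z => by
        have := hgθ (z + τ)
        rw [theta_add_tau, add_right_comm z τ a, theta_add_tau, ← hgθ z,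
          show -(Real.pi * I * (τ + 2 * (z + a) + 1)) =
            -(Real.pi * I * (τ + 2 * z + 1)) + -(2 * Real.pi * I * a) by ring,
          Complex.exp_add] at this
        apply mul_left_cancel₀ (Complex.exp_ne_zero (-(Real.pi * I * (τ + 2 * z + 1))))
        linear_combination this
  refine mem_lattice_of_multiplier hτ hg (x := x - a) (fun h0 => hx ?_) hg1 hg2
  rw [← sub_add_cancel x a, ← hgθ, h0, zero_mul]

/-- `det R(z,λ) = θ(z+γ)/θ(z-γ)` on each two-dimensional weight space. -/
lemma alphaF_mul_sub_betaF_mul {τ γ z μ : ℂ} (hτ : 0 < τ.im) (hμ : theta τ μ ≠ 0)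
    (hz : theta τ (z - γ) ≠ 0) :
    alphaF τ γ z μ * alphaF τ γ z (-μ) - betaF τ γ z μ * betaF τ γ z (-μ) =
      theta τ (z + γ) / theta τ (z - γ) := by
  have h := theta_three_term hτ z γ μ
  rw [alphaF, alphaF, betaF, betaF, theta_neg, ← sub_eq_add_neg, neg_add_eq_sub, add_comm μ γ]
  field_simp
  linear_combination -h

lemma isUnit_Rmat {N : ℕ} {τ γ z : ℂ} {lam : Fin N → ℂ} (hτ : 0 < τ.im)
    (hlam : ∀ i j, i ≠ j → theta τ (lam i - lam j) ≠ 0)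
    (hz : theta τ (z - γ) ≠ 0) (hz' : theta τ (z + γ) ≠ 0) : IsUnit (Rmat N τ γ z lam) := by
  rw [← Matrix.mulVec_injective_iff_isUnit, ← Matrix.coe_mulVecLin,
    ← LinearMap.ker_eq_bot, LinearMap.ker_eq_bot']
  intro v hv
  have hdiag (i : Fin N) : v (i, i) = 0 := by
    have := congrFun hv (i, i)
    simpa [Matrix.mulVec, dotProduct, Rmat] using this
  have hoff (i j : Fin N) (hij : i ≠ j) : alphaF τ γ z (lam i - lam j) * v (i, j) +
      betaF τ γ z (lam i - lam j) * v (j, i) = 0 := by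
    have := congrFun hv (i, j)
    simpa [Matrix.mulVec, dotProduct, Rmat, hij, add_mul, Finset.sum_add_distrib] using this
  ext ⟨i, j⟩
  rcases eq_or_ne i j with rfl | hij
  · exact hdiag i
  · have h1 := hoff i j hij
    have h2 := hoff j i hij.symm
    have hdet := alphaF_mul_sub_betaF_mul (γ := γ) (z := z) hτ (hlam i j hij) hz
    rw [neg_sub] at hdet
    have hne := div_ne_zero hz' hz
    rw [← hdet] at hne
    apply (mul_eq_zero.1 _).resolve_left hne
    linear_combination alphaF τ γ z (lam j - lam i) * h1 - betaF τ γ z (lam i - lam j) * h2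

lemma dense_theta_ne_zero {τ : ℂ} (hτ : 0 < τ.im) : Dense {z | theta τ z ≠ 0} := by
  obtain ⟨x, hx⟩ := exists_theta_ne_zero hτ
  intro z
  exact mem_closure_of_frequently_of_tendsto
    (eventually_ne_zero_of_entire (differentiable_theta hτ) hx z).frequently
    (tendsto_id.mono_left nhdsWithin_le_nhds)

/-- for generic `(γ,λ)`, `R(z,λ)` is invertible for all
`z ∉ (±γ + ℤ + τℤ)`. -/
theorem R_nonsingular_generic (N : ℕ) (hN : 2 ≤ N) (τ : ℂ) (hτ : 0 < τ.im) :
    ∃ U : Set (ℂ × (Fin N → ℂ)), IsOpen U ∧ Dense U ∧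
      ∀ γ : ℂ, ∀ lam : Fin N → ℂ, (γ, lam) ∈ U → ∀ z : ℂ,
        (¬ ∃ a b : ℤ, z = γ + (a : ℂ) + (b : ℂ) * τ) →
        (¬ ∃ a b : ℤ, z = -γ + (a : ℂ) + (b : ℂ) * τ) →
        IsUnit (Rmat N τ γ z lam) := by
  refine ⟨⋂ p : {p : Fin N × Fin N // p.1 ≠ p.2},
    {q | theta τ (q.2 p.1.1 - q.2 p.1.2) ≠ 0}, ?_, ?_, ?_⟩
  · refine isOpen_iInter_of_finite fun p => ?_
    exact isOpen_ne_fun ((differentiable_theta hτ).continuous.comp (by fun_prop)) continuous_const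
  · refine dense_iInter_of_isOpen (fun p => ?_) fun p => ?_
    · exact isOpen_ne_fun ((differentiable_theta hτ).continuous.comp (by fun_prop))
        continuous_const
    · let φ : (ℂ × (Fin N → ℂ)) →L[ℂ] ℂ :=
        (ContinuousLinearMap.proj (R := ℂ) (φ := fun _ : Fin N => ℂ) p.1.1 -
          ContinuousLinearMap.proj (R := ℂ) (φ := fun _ : Fin N => ℂ) p.1.2).comp (ContinuousLinearMap.snd ℂ ℂ (Fin N → ℂ))
      have hφ : Function.Surjective φ := fun w =>
        ⟨(0, Pi.single p.1.1 w), by simp [φ, Pi.single_eq_of_ne p.2.symm]⟩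
      exact (dense_theta_ne_zero hτ).preimage (φ.isOpenMap hφ)
  · intro γ lam hU z hz hz'
    rw [Set.mem_iInter] at hU
    refine isUnit_Rmat hτ (fun i j hij => hU ⟨(i, j), hij⟩) (fun h => hz ?_) fun h => hz' ?_
    · obtain ⟨m, n, h⟩ := mem_lattice_of_theta_eq_zero hτ h
      exact ⟨m, n, by linear_combination h⟩
    · obtain ⟨m, n, h⟩ := mem_lattice_of_theta_eq_zero hτ h
      exact ⟨m, n, by linear_combination h⟩

end EllipticQG
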